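/- Let Q ∈ ℝ^{m×r} and Q_⊥ ∈ ℝ^{m×(m−r)} form an orthogonal completion, let Y ∈ ℝ^{m×s}, and assume N := Yᵀ Q has full column rank r. Then for every B ∈ ℝ^{m×q}, ‖Q N† Yᵀ B‖_F ≤ ‖B‖_F · (1 + ‖N† (Yᵀ Q_⊥)‖₂), where N† = (NᵀN)⁻¹Nᵀ. -/

import Mathlib

open scoped BigOperators Matrix

/-- Frobenius norm of a real matrix. -/
noncomputable def frobNorm {α β : Type*} [Fintype α] [Fintype β] (M : Matrix α β ℝ) : ℝ :=
  Real.sqrt (∑ i, ∑ j, (M i j) ^ 2)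

/-- Spectral norm (operator norm induced by Euclidean vector norms). -/
noncomputable def specNorm {α β : Type*} [Fintype α] [Fintype β] [DecidableEq β]
    (M : Matrix α β ℝ) : ℝ :=
  ‖(Matrix.toEuclideanLin M).toContinuousLinearMap‖

/-- Moore–Penrose pseudoinverse of a full-column-rank matrix: `(MᵀM)⁻¹Mᵀ`. -/
noncomputable def pinvCol {α β : Type*} [Fintype α] [Fintype β] [DecidableEq β]
    (M : Matrix α β ℝ) : Matrix β α ℝ := (Mᵀ * M)⁻¹ * Mᵀ

section FrobeniusNorm

variable {α β γ : Type*} [Fintype α] [Fintype β] [Fintype γ]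

theorem frobNorm_nonneg (M : Matrix α β ℝ) : 0 ≤ frobNorm M := Real.sqrt_nonneg _

theorem frobNorm_sq (M : Matrix α β ℝ) : frobNorm M ^ 2 = ∑ i, ∑ j, M i j ^ 2 :=
  Real.sq_sqrt (by positivity)

theorem frobNorm_sq_eq_trace (M : Matrix α β ℝ) : frobNorm M ^ 2 = (Mᵀ * M).trace := by
  rw [frobNorm_sq, Finset.sum_comm]
  simp [Matrix.trace, Matrix.mul_apply, sq]

theorem frobNorm_add_le (A B : Matrix α β ℝ) : frobNorm (A + B) ≤ frobNorm A + frobNorm B := by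
  let : NormedAddCommGroup (Matrix α β ℝ) := Matrix.frobeniusNormedAddCommGroup
  have h (M : Matrix α β ℝ) : frobNorm M = ‖M‖ := by
    rw [Matrix.frobenius_norm_def, frobNorm, Real.sqrt_eq_rpow]
    simp
  simpa only [h] using norm_add_le A B

theorem specNorm_nonneg [DecidableEq β] (M : Matrix α β ℝ) : 0 ≤ specNorm M := norm_nonneg _

theorem sum_mulVec_sq_le [DecidableEq β] (M : Matrix α β ℝ) (x : β → ℝ) :
    ∑ i, (M *ᵥ x) i ^ 2 ≤ specNorm M ^ 2 * ∑ j, x j ^ 2 := by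
  have h := (Matrix.toEuclideanLin M).toContinuousLinearMap.le_opNorm (WithLp.toLp 2 x)
  have h2 := pow_le_pow_left₀ (norm_nonneg _) h 2
  rw [mul_pow, EuclideanSpace.norm_sq_eq, EuclideanSpace.norm_sq_eq] at h2
  simpa [specNorm] using h2

theorem frobNorm_mul_le [DecidableEq β] (M : Matrix α β ℝ) (X : Matrix β γ ℝ) :
    frobNorm (M * X) ≤ specNorm M * frobNorm X := by
  refine le_of_sq_le_sq ?_ (mul_nonneg (specNorm_nonneg M) (frobNorm_nonneg X))
  rw [mul_pow, frobNorm_sq, frobNorm_sq, Finset.sum_comm (f := fun i k => (M * X) i k ^ 2),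
    Finset.sum_comm (f := fun j k => X j k ^ 2), Finset.mul_sum]
  exact Finset.sum_le_sum fun k _ => sum_mulVec_sq_le M fun j => X j k

theorem frobNorm_mul_of_transpose_mul_self_eq_one [DecidableEq β] {Q : Matrix α β ℝ}
    (hQ : Qᵀ * Q = 1) (X : Matrix β γ ℝ) : frobNorm (Q * X) = frobNorm X := by
  rw [← sq_eq_sq₀ (frobNorm_nonneg _) (frobNorm_nonneg _), frobNorm_sq_eq_trace,
    frobNorm_sq_eq_trace, Matrix.transpose_mul, Matrix.mul_assoc, ← Matrix.mul_assoc Qᵀ, hQ,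
    Matrix.one_mul]

theorem frobNorm_sq_add_sq_of_completion {δ : Type*} [Fintype δ] [DecidableEq α]
    {Q : Matrix α β ℝ} {P : Matrix α δ ℝ} (h : Q * Qᵀ + P * Pᵀ = 1) (B : Matrix α γ ℝ) :
    frobNorm (Qᵀ * B) ^ 2 + frobNorm (Pᵀ * B) ^ 2 = frobNorm B ^ 2 := by
  simp only [frobNorm_sq_eq_trace]
  rw [← Matrix.trace_add]
  congr 1
  calc _ = Bᵀ * ((Q * Qᵀ + P * Pᵀ) * B) := by
        simp [Matrix.mul_add, Matrix.add_mul, Matrix.mul_assoc]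
    _ = Bᵀ * B := by rw [h, Matrix.one_mul]

end FrobeniusNorm

theorem pinvCol_mul_self {α β : Type*} [Fintype α] [Fintype β] [DecidableEq β]
    {N : Matrix α β ℝ} (hN : N.rank = Fintype.card β) : pinvCol N * N = 1 := by
  have hu : IsUnit (Nᵀ * N) := by
    rw [← Matrix.mulVec_surjective_iff_isUnit]
    refine LinearMap.range_eq_top.mp
      (Submodule.eq_top_of_finrank_eq (S := (Nᵀ * N).mulVecLin.range) ?_)
    rw [Module.finrank_fintype_fun_eq_card, ← hN, ← Matrix.rank_transpose_mul_self]
    rfl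
  rw [pinvCol, Matrix.mul_assoc,
    Matrix.nonsing_inv_mul _ ((Matrix.isUnit_iff_isUnit_det _).mp hu)]

/-- If `(Q, Q_⊥)` is an orthogonal completion and `N = Yᵀ Q` has full column rank, then
`‖Q N† Yᵀ B‖_F ≤ ‖B‖_F (1 + ‖N† (YᵀQ_⊥)‖₂)` for every `B`. -/
theorem orthogonal_completion_projection_bound
    {m r s q : ℕ}
    (Q : Matrix (Fin m) (Fin r) ℝ) (Qp : Matrix (Fin m) (Fin (m - r)) ℝ)
    (hQ : Qᵀ * Q = 1) (hQp : Qpᵀ * Qp = 1) (hQQp : Qᵀ * Qp = 0)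
    (hcomp : Q * Qᵀ + Qp * Qpᵀ = 1)
    (Y : Matrix (Fin m) (Fin s) ℝ)
    (hN : (Yᵀ * Q).rank = r) :
    ∀ B : Matrix (Fin m) (Fin q) ℝ,
      frobNorm (Q * pinvCol (Yᵀ * Q) * Yᵀ * B) ≤
        frobNorm B * (1 + specNorm (pinvCol (Yᵀ * Q) * (Yᵀ * Qp))) := by
  intro B
  set C := pinvCol (Yᵀ * Q) * (Yᵀ * Qp) with hC
  have hinv : pinvCol (Yᵀ * Q) * (Yᵀ * Q) = 1 := pinvCol_mul_self (by simpa using hN)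
  have hsplit : pinvCol (Yᵀ * Q) * Yᵀ * B = Qᵀ * B + C * (Qpᵀ * B) := by
    calc _ = pinvCol (Yᵀ * Q) * Yᵀ * ((Q * Qᵀ + Qp * Qpᵀ) * B) := by
          rw [hcomp, Matrix.one_mul]
      _ = pinvCol (Yᵀ * Q) * (Yᵀ * Q) * (Qᵀ * B) + C * (Qpᵀ * B) := by
          simp only [hC, Matrix.mul_add, Matrix.add_mul, Matrix.mul_assoc]
      _ = _ := by rw [hinv, Matrix.one_mul]
  have hpyth := frobNorm_sq_add_sq_of_completion hcomp B
  have hle : frobNorm (Qᵀ * B) ≤ frobNorm B :=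
    le_of_sq_le_sq (by nlinarith [sq_nonneg (frobNorm (Qpᵀ * B))]) (frobNorm_nonneg B)
  have hlep : frobNorm (Qpᵀ * B) ≤ frobNorm B :=
    le_of_sq_le_sq (by nlinarith [sq_nonneg (frobNorm (Qᵀ * B))]) (frobNorm_nonneg B)
  calc frobNorm (Q * pinvCol (Yᵀ * Q) * Yᵀ * B)
      = frobNorm (Qᵀ * B + C * (Qpᵀ * B)) := by
        rw [← hsplit, ← frobNorm_mul_of_transpose_mul_self_eq_one hQ]
        simp only [Matrix.mul_assoc]
    _ ≤ frobNorm (Qᵀ * B) + specNorm C * frobNorm (Qpᵀ * B) :=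
        (frobNorm_add_le _ _).trans (by gcongr; exact frobNorm_mul_le _ _)
    _ ≤ frobNorm B + specNorm C * frobNorm B := by
        gcongr
        exact specNorm_nonneg C
    _ = frobNorm B * (1 + specNorm C) := by ring
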